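/- Let w ∈ 𝒮_n and suppose there is an index i with w_i = w_{i+1} = 2, or an index i with w_i = w_{i+1} = n−1. Then the complex ⟦w⟧ is chain homotopy equivalent to the zero complex; in particular H_*⟦w⟧ = 0. -/

import Mathlib

namespace Nil

/-- Index pairs `(a,b)` with `a < b` in `Fin n`, indexing the basis `e_{ab}` of `nil_n`. -/
abbrev P (n : ℕ) : Type := {p : Fin n × Fin n // p.1 < p.2}

/-- Lexicographic key of a pair. -/
def key {n : ℕ} (p : P n) : ℕ := p.1.1.1 * n + p.1.2.1

/-- Position (0-based) of `a` in the lexicographically sorted list of `M`. -/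
def pos {n : ℕ} (M : Finset (P n)) (a : P n) : ℕ :=
  (M.filter fun b => key b < key a).card

/-- Basis of the degree `k` part of the Chevalley-Eilenberg complex `Λ^* nil_n`:
subsets `M` of pairs with `|M| = k` (empty for `k < 0`). -/
abbrev B (n : ℕ) (k : ℤ) : Type := {M : Finset (P n) // (M.card : ℤ) = k}

/-- Degree `k` chain group of the Chevalley-Eilenberg complex of `nil_n`. -/
abbrev C (n : ℕ) (k : ℤ) : Type := B n k →₀ ℤ

/-- The Chevalley-Eilenberg boundary of a basis wedge `e_M`:
`∂(e_{a₁b₁} ∧ … ∧ e_{aₖbₖ}) = Σ_{i<j} (-1)^{i+j} [e_{aᵢbᵢ}, e_{aⱼbⱼ}] ∧ …` (omitting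
the i-th and j-th factors), written in the lexicographically sorted basis.
For lexicographically sorted wedges the only nonzero brackets come from pairs
`a = (x,y)`, `b = (y,z)`, producing `±e_{(x,z)}`. -/
noncomputable def dAux {n : ℕ} (k : ℤ) (M : Finset (P n)) : C n k :=
  ∑ a ∈ M, ∑ b ∈ M,
    if hab : a.1.2 = b.1.1 then
      (let c : P n := ⟨(a.1.1, b.1.2), lt_trans a.2 (by rw [hab]; exact b.2)⟩
       let M' : Finset (P n) := insert c ((M.erase a).erase b)
       if h' : (M'.card : ℤ) = k then
         ((-1 : ℤ) ^ (pos M a + pos M b + pos M' c)) • Finsupp.single (⟨M', h'⟩ : B n k) 1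
       else 0)
    else 0

/-- The Chevalley-Eilenberg boundary map in degree `k+1`. -/
noncomputable def d (n : ℕ) (k : ℤ) : C n (k + 1) →ₗ[ℤ] C n k :=
  Finsupp.lsum ℤ fun M => LinearMap.toSpanSingleton ℤ (C n k) (dAux k M.1)

/-- Degree-cast isomorphism. -/
noncomputable def castC (n : ℕ) {k l : ℤ} (h : k = l) : C n k ≃ₗ[ℤ] C n l :=
  Finsupp.domLCongr (Equiv.subtypeEquivRight fun _ => by rw [h])

/-- The boundary map out of degree `k`. -/
noncomputable def dFrom (n : ℕ) (k : ℤ) : C n k →ₗ[ℤ] C n (k - 1) :=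
  (d n (k - 1)).comp (castC n (by ring : k = k - 1 + 1)).toLinearMap

/-- Cycles of `Λ^* nil_n` in degree `k`. -/
noncomputable def Zfull (n : ℕ) (k : ℤ) : Submodule ℤ (C n k) := LinearMap.ker (dFrom n k)

noncomputable def HnilSub (n : ℕ) (k : ℤ) : Submodule ℤ (Zfull n k) :=
  Submodule.comap (Zfull n k).subtype (LinearMap.range (d n k) ⊓ Zfull n k)

/-- `H_k(nil_n; ℤ)`: the `k`-th integral homology of the Chevalley-Eilenberg complex
of the Lie ring of strictly upper triangular `n × n` integer matrices. -/
noncomputable def Hnil (n : ℕ) (k : ℤ) : Type := Zfull n k ⧸ HnilSub n k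

noncomputable instance (n : ℕ) (k : ℤ) : AddCommGroup (Hnil n k) :=
  inferInstanceAs (AddCommGroup (Zfull n k ⧸ HnilSub n k))

noncomputable instance (n : ℕ) (k : ℤ) : Module ℤ (Hnil n k) :=
  inferInstanceAs (Module ℤ (Zfull n k ⧸ HnilSub n k))

/-- The modified weight of a basis wedge `e_M` (indices of `Fin n` are 0-based, so the
`i`-th weight of the paper, `1 ≤ i ≤ n`, is `wt M ⟨i-1,_⟩`):
`w_i(e_M) = i - #{x : (x,i) ∈ M} + #{y : (i,y) ∈ M}`. -/
def wt {n : ℕ} (M : Finset (P n)) : Fin n → ℤ := fun i =>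
  ((i.1 : ℤ) + 1) - (M.filter fun p => p.1.2 = i).card + (M.filter fun p => p.1.1 = i).card

/-- Basis wedges of degree `k` and modified weight `w`. -/
abbrev Bw (n : ℕ) (k : ℤ) (w : Fin n → ℤ) : Type :=
  {M : Finset (P n) // (M.card : ℤ) = k ∧ wt M = w}

/-- Degree `k` part of the weight summand `⟦w⟧` of `Λ^* nil_n`. -/
abbrev Cw (n : ℕ) (k : ℤ) (w : Fin n → ℤ) : Type := Bw n k w →₀ ℤ

/-- Inclusion of the weight summand. -/
noncomputable def inclW (n : ℕ) (k : ℤ) (w : Fin n → ℤ) : Cw n k w →ₗ[ℤ] C n k :=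
  Finsupp.lmapDomain ℤ ℤ fun M => (⟨M.1, M.2.1⟩ : B n k)

/-- Projection onto the weight summand. -/
noncomputable def projW (n : ℕ) (k : ℤ) (w : Fin n → ℤ) : C n k →ₗ[ℤ] Cw n k w :=
  Finsupp.lsum ℤ fun M =>
    if h : wt M.1 = w then
      LinearMap.toSpanSingleton ℤ (Cw n k w) (Finsupp.single (⟨M.1, M.2, h⟩ : Bw n k w) 1)
    else 0

/-- The boundary of the weight summand `⟦w⟧` (the boundary preserves weights, so this
is the restriction of the Chevalley-Eilenberg boundary). -/
noncomputable def dW (n : ℕ) (k : ℤ) (w : Fin n → ℤ) : Cw n (k + 1) w →ₗ[ℤ] Cw n k w :=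
  (projW n k w) ∘ₗ (d n k) ∘ₗ (inclW n (k + 1) w)

noncomputable def castCw (n : ℕ) (w : Fin n → ℤ) {k l : ℤ} (h : k = l) :
    Cw n k w ≃ₗ[ℤ] Cw n l w :=
  Finsupp.domLCongr (Equiv.subtypeEquivRight fun _ => by rw [h])

noncomputable def dFromW (n : ℕ) (k : ℤ) (w : Fin n → ℤ) : Cw n k w →ₗ[ℤ] Cw n (k - 1) w :=
  (dW n (k - 1) w).comp (castCw n w (by ring : k = k - 1 + 1)).toLinearMap

noncomputable def ZW (n : ℕ) (k : ℤ) (w : Fin n → ℤ) : Submodule ℤ (Cw n k w) :=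
  LinearMap.ker (dFromW n k w)

noncomputable def HwSub (n : ℕ) (k : ℤ) (w : Fin n → ℤ) : Submodule ℤ (ZW n k w) :=
  Submodule.comap (ZW n k w).subtype (LinearMap.range (dW n k w) ⊓ ZW n k w)

/-- `H_k⟦w⟧`: the `k`-th homology of the weight summand `⟦w⟧` of `Λ^* nil_n`. -/
noncomputable def Hw (n : ℕ) (k : ℤ) (w : Fin n → ℤ) : Type := ZW n k w ⧸ HwSub n k w

noncomputable instance (n : ℕ) (k : ℤ) (w : Fin n → ℤ) : AddCommGroup (Hw n k w) :=
  inferInstanceAs (AddCommGroup (ZW n k w ⧸ HwSub n k w))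

noncomputable instance (n : ℕ) (k : ℤ) (w : Fin n → ℤ) : Module ℤ (Hw n k w) :=
  inferInstanceAs (Module ℤ (ZW n k w ⧸ HwSub n k w))

/-- `w ∈ 𝒮_n`: all entries lie in `{1,…,n}` and they add up to `binom (n+1) 2`. -/
def Sn (n : ℕ) (w : Fin n → ℤ) : Prop :=
  (∀ i, 1 ≤ w i ∧ w i ≤ (n : ℤ)) ∧ 2 * ∑ i, w i = (n : ℤ) * ((n : ℤ) + 1)

/-- Number of inversions of a permutation of `Fin n`. -/
def invCount (n : ℕ) (π : Equiv.Perm (Fin n)) : ℕ :=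
  (Finset.univ.filter fun p : Fin n × Fin n => p.1 < p.2 ∧ π p.2 < π p.1).card

/-- The weight sequence `(π(1), …, π(n))` attached to a permutation (1-based values). -/
def permWt (n : ℕ) (π : Equiv.Perm (Fin n)) : Fin n → ℤ := fun i => ((π i).1 : ℤ) + 1

/-- The set of inversions of a permutation, as a set of index pairs. -/
def invFinset {n : ℕ} (π : Equiv.Perm (Fin n)) : Finset (P n) :=
  Finset.univ.filter fun p => π p.1.2 < π p.1.1

/-- Index reversal `i ↦ n+1-i` (0-based: `i ↦ n-1-i`). -/
def rev {n : ℕ} (i : Fin n) : Fin n := ⟨n - 1 - i.1, by have := i.isLt; omega⟩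


/-- Coefficient functions on all basis wedges, of every degree and weight. -/
abbrev Fock (n : ℕ) : Type := Finset (P n) → ℤ

/-- The sign picked up when `e_p` is moved past the factors of `e_S` preceding it. -/
def sgn {n : ℕ} (p : P n) (S : Finset (P n)) : ℤ := (-1) ^ pos S p

lemma key_injective {n : ℕ} : Function.Injective (key : P n → ℕ) := by
  rintro ⟨⟨a, b⟩, h⟩ ⟨⟨c, e⟩, h'⟩ hk
  simp only [key] at hk
  have hn : 0 < n := a.pos
  have h1 := congrArg (· / n) hk
  have h2 := congrArg (· % n) hk
  simp only [Nat.mul_add_mod_self_right, Nat.mod_eq_of_lt b.2, Nat.mod_eq_of_lt e.2] at h2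
  simp only [mul_comm _ n, Nat.mul_add_div hn, Nat.div_eq_of_lt b.2, Nat.div_eq_of_lt e.2,
    add_zero] at h1
  simp [Fin.ext_iff, h1, h2]

lemma sgn_insert {n : ℕ} (p q : P n) {S : Finset (P n)} (h : q ∉ S) :
    sgn p (insert q S) = (if key q < key p then -1 else 1) * sgn p S := by
  unfold sgn pos
  rw [Finset.filter_insert]
  split_ifs
  · rw [Finset.card_insert_of_notMem (by simp [h]), pow_succ']
  · simp

lemma sgn_erase {n : ℕ} (p q : P n) {S : Finset (P n)} (h : q ∈ S) :
    sgn p (S.erase q) = (if key q < key p then -1 else 1) * sgn p S := by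
  conv_rhs => rw [← Finset.insert_erase h, sgn_insert p q (Finset.notMem_erase q S)]
  split_ifs <;> simp

@[simp] lemma sgn_mul_self {n : ℕ} (p : P n) (S : Finset (P n)) : sgn p S * sgn p S = 1 := by
  simp [sgn, ← mul_pow]

/-- Contraction with the dual basis vector of `e_p`. -/
def ann {n : ℕ} (p : P n) : Module.End ℤ (Fock n) where
  toFun v S := if p ∈ S then 0 else sgn p S * v (insert p S)
  map_add' u v := by ext S; dsimp only [Pi.add_apply]; split_ifs <;> ring
  map_smul' c v := by
    ext S; simp only [Pi.smul_apply, smul_eq_mul, RingHom.id_apply]; split_ifs <;> ring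

/-- Left wedge multiplication by `e_p`. -/
def cre {n : ℕ} (p : P n) : Module.End ℤ (Fock n) where
  toFun v S := if p ∈ S then sgn p S * v (S.erase p) else 0
  map_add' u v := by ext S; dsimp only [Pi.add_apply]; split_ifs <;> ring
  map_smul' c v := by
    ext S; simp only [Pi.smul_apply, smul_eq_mul, RingHom.id_apply]; split_ifs <;> ring

lemma ann_apply {n : ℕ} (p : P n) (v : Fock n) (S : Finset (P n)) :
    ann p v S = if p ∈ S then 0 else sgn p S * v (insert p S) := rfl

lemma cre_apply {n : ℕ} (p : P n) (v : Fock n) (S : Finset (P n)) :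
    cre p v S = if p ∈ S then sgn p S * v (S.erase p) else 0 := rfl

lemma key_ite {n : ℕ} {p q : P n} (h : p ≠ q) :
    (if key p < key q then -1 else 1 : ℤ) = -(if key q < key p then -1 else 1) := by
  have := key_injective.ne h
  split_ifs <;> omega

lemma ann_anticomm {n : ℕ} (p q : P n) : ann p * ann q + ann q * ann p = 0 := by
  refine LinearMap.ext fun v => funext fun S => ?_
  simp only [LinearMap.add_apply, Module.End.mul_apply, Pi.add_apply, ann_apply,
    Finset.mem_insert, LinearMap.zero_apply, Pi.zero_apply]
  rcases eq_or_ne p q with rfl | h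
  · simp
  by_cases hp : p ∈ S <;> by_cases hq : q ∈ S <;> simp only [hp, hq, h, h.symm, or_false, if_true,
    if_false, or_true, mul_zero, add_zero]
  rw [sgn_insert q p hp, sgn_insert p q hq, Finset.insert_comm q p, key_ite h]
  ring

lemma cre_anticomm {n : ℕ} (p q : P n) : cre p * cre q + cre q * cre p = 0 := by
  refine LinearMap.ext fun v => funext fun S => ?_
  simp only [LinearMap.add_apply, Module.End.mul_apply, Pi.add_apply, cre_apply,
    Finset.mem_erase, LinearMap.zero_apply, Pi.zero_apply]
  rcases eq_or_ne p q with rfl | h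
  · simp
  by_cases hp : p ∈ S <;> by_cases hq : q ∈ S <;> simp only [hp, hq, h, h.symm, ne_eq,
    not_false_eq_true, and_self, if_true, and_false, if_false, mul_zero, add_zero]
  rw [sgn_erase q p hp, sgn_erase p q hq, Finset.erase_right_comm, key_ite h]
  ring

lemma ann_cre {n : ℕ} (p q : P n) :
    ann p * cre q + cre q * ann p = if p = q then 1 else 0 := by
  refine LinearMap.ext fun v => funext fun S => ?_
  simp only [LinearMap.add_apply, Module.End.mul_apply, Pi.add_apply, ann_apply, cre_apply,
    Finset.mem_insert, Finset.mem_erase]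
  rcases eq_or_ne p q with rfl | h
  · by_cases hp : p ∈ S
    · simp [hp, sgn_erase p p hp, ← mul_assoc]
    · simp [hp, sgn_insert p p hp, ← mul_assoc]
  · by_cases hp : p ∈ S <;> by_cases hq : q ∈ S <;> simp [hp, hq, h, h.symm]
    rw [sgn_insert q p hp, sgn_erase p q hq, Finset.erase_insert_of_ne h, key_ite h]
    ring

/-- `ann` of the pair `(x, y)`, and `0` unless `x < y`. -/
def A {n : ℕ} (x y : Fin n) : Module.End ℤ (Fock n) := if h : x < y then ann ⟨(x, y), h⟩ else 0

/-- `cre` of the pair `(x, y)`, and `0` unless `x < y`. -/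
def E {n : ℕ} (x y : Fin n) : Module.End ℤ (Fock n) := if h : x < y then cre ⟨(x, y), h⟩ else 0

lemma A_eq_zero {n : ℕ} {x y : Fin n} (h : ¬ x < y) : A x y = 0 := dif_neg h

lemma E_eq_zero {n : ℕ} {x y : Fin n} (h : ¬ x < y) : E x y = 0 := dif_neg h

lemma A_mul_A {n : ℕ} (x y u v : Fin n) : A x y * A u v = -(A u v * A x y) := by
  unfold A
  split_ifs <;> simp [eq_neg_iff_add_eq_zero, ann_anticomm]

lemma E_mul_E {n : ℕ} (x y u v : Fin n) : E x y * E u v = -(E u v * E x y) := by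
  unfold E
  split_ifs <;> simp [eq_neg_iff_add_eq_zero, cre_anticomm]

/-- The value `0` or `1` of the anticommutator of `A x y` and `E u v`. -/
def delta {n : ℕ} (x y u v : Fin n) : Module.End ℤ (Fock n) :=
  if x < y ∧ x = u ∧ y = v then 1 else 0

lemma A_mul_E {n : ℕ} (x y u v : Fin n) :
    A x y * E u v = delta x y u v - E u v * A x y := by
  rw [eq_sub_iff_add_eq]
  unfold A E delta
  split_ifs with h1 h2 h3 h3 h3 h4 h4 <;> simp [ann_cre] <;> grind

lemma delta_mul {n : ℕ} (x y u v : Fin n) (X : Module.End ℤ (Fock n)) :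
    delta x y u v * X = X * delta x y u v := by
  unfold delta; split_ifs <;> simp

/-- The Chevalley–Eilenberg boundary on `Fock n`. -/
def D (n : ℕ) : Module.End ℤ (Fock n) := ∑ x, ∑ y, ∑ z, E x z * A x y * A y z

/-- The anticommutator of the boundary with `A u v`. -/
lemma D_mul_A {n : ℕ} (u v : Fin n) : D n * A u v = ∑ y, A u y * A y v - A u v * D n := by
  have key (x y z : Fin n) : E x z * A x y * A y z * A u v
      = delta u v x z * A x y * A y z - A u v * (E x z * A x y * A y z) := by
    have h1 := A_mul_A y z u v
    have h2 := A_mul_A x y u v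
    have h3 := A_mul_E u v x z
    calc _ = E x z * A x y * (A y z * A u v) := by noncomm_ring
      _ = -(E x z * (A x y * A u v) * A y z) := by rw [h1]; noncomm_ring
      _ = (E x z * A u v) * A x y * A y z := by rw [h2]; noncomm_ring
      _ = _ := by rw [← mul_assoc, ← mul_assoc, h3]; noncomm_ring
  simp only [D, Finset.sum_mul, Finset.mul_sum, key, Finset.sum_sub_distrib]
  congr 1
  rw [Finset.sum_eq_single u, Finset.sum_congr rfl]
  · intro y _
    rw [Finset.sum_eq_single v]
    · by_cases h : u < v
      · simp [delta, h]
      · have : A u y * A y v = 0 := by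
          by_cases h' : u < y
          · rw [A_eq_zero (x := y) (y := v) (by order), mul_zero]
          · rw [A_eq_zero h', zero_mul]
        simp [mul_assoc, this]
    · intro z _ hz; simp [delta, hz.symm]
    · simp
  · intro x _ hx; simp [delta, hx.symm]
  · simp

lemma D_sq (n : ℕ) : D n * D n = 0 := by
  have hq (u v : Fin n) : D n * ∑ y, A u y * A y v = (∑ y, A u y * A y v) * D n := by
    have h (y : Fin n) : D n * (A u y * A y v) = (∑ t, A u t * A t y * A y v)
        - (∑ t, A u y * A y t * A t v) + A u y * A y v * D n := by
      rw [← mul_assoc, D_mul_A, sub_mul, mul_assoc (A u y), D_mul_A, mul_sub, Finset.sum_mul,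
        Finset.mul_sum]
      simp only [mul_assoc]
      abel
    rw [Finset.mul_sum, Finset.sum_mul]
    simp only [h, Finset.sum_add_distrib, Finset.sum_sub_distrib]
    rw [Finset.sum_comm, sub_self, zero_add]
  have hA (u v : Fin n) : A u v * (D n * D n) = D n * D n * A u v := by
    rw [mul_assoc (D n), D_mul_A, mul_sub, hq, ← mul_assoc (D n), D_mul_A, sub_mul, mul_assoc,
      sub_sub_cancel]
  refine LinearMap.ext fun v => funext fun S => ?_
  induction S using Finset.induction_on generalizing v with
  | empty =>
    simp only [Module.End.mul_apply, LinearMap.zero_apply, Pi.zero_apply]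
    generalize D n v = w
    simp only [D, LinearMap.sum_apply, Finset.sum_apply, Module.End.mul_apply]
    refine Finset.sum_eq_zero fun x _ => Finset.sum_eq_zero fun y _ =>
      Finset.sum_eq_zero fun z _ => ?_
    unfold E
    split_ifs <;> simp [cre_apply]
  | insert p S hp ih =>
    have h := congrFun (congrArg (· v) (hA p.1.1 p.1.2)) S
    have ih' := ih (A p.1.1 p.1.2 v)
    simp only [Module.End.mul_apply, LinearMap.zero_apply, Pi.zero_apply] at h ih' ⊢
    rw [ih'] at h
    simpa [A, p.2, ann_apply, hp, sgn] using h

/-- The anticommutator of the boundary with `E u v`: up to sign, the (co)adjoint action of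
`e_{uv}` on the exterior algebra. -/
def R {n : ℕ} (u v : Fin n) : Module.End ℤ (Fock n) :=
  ∑ x, E x v * A x u - ∑ z, E u z * A v z

lemma D_mul_E {n : ℕ} {u v : Fin n} (h : u < v) : D n * E u v = R u v - E u v * D n := by
  have key (x y z : Fin n) : E x z * A x y * A y z * E u v
      = E x z * A x y * delta y z u v - E x z * A y z * delta x y u v
        - E u v * (E x z * A x y * A y z) := by
    have h1 := A_mul_E y z u v
    have h2 := A_mul_E x y u v
    have h3 := E_mul_E x z u v
    calc _ = E x z * A x y * (A y z * E u v) := by noncomm_ring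
      _ = E x z * A x y * delta y z u v - E x z * (A x y * E u v) * A y z := by
        rw [h1]; noncomm_ring
      _ = E x z * A x y * delta y z u v - E x z * (delta x y u v * A y z)
          + (E x z * E u v) * A x y * A y z := by rw [h2]; noncomm_ring
      _ = _ := by rw [h3, delta_mul]; noncomm_ring
  simp only [D, R, Finset.sum_mul, Finset.mul_sum, key, Finset.sum_sub_distrib]
  congr 2
  · refine Finset.sum_congr rfl fun x _ => ?_
    rw [Finset.sum_eq_single u, Finset.sum_eq_single v]
    · simp [delta, h]
    · intro z _ hz; simp [delta, hz]
    · simp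
    · intro y _ hy; simp [delta, hy]
    · simp
  · rw [Finset.sum_eq_single u, Finset.sum_eq_single v]
    · simp [delta, h]
    · intro z _ hz; simp [delta, hz]
    · simp
    · intro y _ hy; simp [delta, hy]
    · simp

lemma R_mul_A {n : ℕ} (i j r s : Fin n) : R i j * A r s = A r s * R i j
    - (∑ x, delta r s x j * A x i - ∑ z, delta r s i z * A j z) := by
  have key (x y u v : Fin n) : E x y * A u v * A r s
      = A r s * (E x y * A u v) - delta r s x y * A u v := by
    have h1 := A_mul_A u v r s
    have h2 := A_mul_E r s x y
    calc _ = E x y * (A u v * A r s) := by noncomm_ring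
      _ = _ := by rw [h1, ← mul_assoc (A r s), h2]; noncomm_ring
  simp only [R, sub_mul, Finset.sum_mul, key, mul_sub, Finset.mul_sum, Finset.sum_sub_distrib]
  abel

lemma R_mul_E {n : ℕ} (i j r s : Fin n) : R i j * E r s = E r s * R i j
    + (∑ x, E x j * delta x i r s - ∑ z, E i z * delta j z r s) := by
  have key (x y u v : Fin n) : E x y * A u v * E r s
      = E r s * (E x y * A u v) + E x y * delta u v r s := by
    have h1 := E_mul_E x y r s
    have h2 := A_mul_E u v r s
    calc _ = E x y * (A u v * E r s) := by noncomm_ring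
      _ = E x y * delta u v r s - (E x y * E r s) * A u v := by rw [h2]; noncomm_ring
      _ = _ := by rw [h1]; noncomm_ring
  simp only [R, sub_mul, Finset.sum_mul, key, mul_sub, Finset.mul_sum, Finset.sum_add_distrib]
  abel

lemma A_self {n : ℕ} (x : Fin n) : A x x = 0 := A_eq_zero (lt_irrefl x)

lemma E_self {n : ℕ} (x : Fin n) : E x x = 0 := E_eq_zero (lt_irrefl x)

lemma R_comm_A {n : ℕ} (i j : Fin n) : R i j * A i j = A i j * R i j := by
  rw [R_mul_A, sub_eq_self, Finset.sum_eq_zero, Finset.sum_eq_zero, sub_zero]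
  all_goals
    intro x _
    unfold delta
    split_ifs with hx
    · first
      | rw [hx.2.1, A_self, mul_zero]
      | rw [hx.2.2, A_self, mul_zero]
    · simp

lemma R_comm_E {n : ℕ} {i j : Fin n} (h : i ≠ j) : R i j * E i j = E i j * R i j := by
  rw [R_mul_E, add_eq_left, Finset.sum_eq_zero, Finset.sum_eq_zero, sub_zero]
  all_goals
    intro x _
    rw [delta, if_neg (by tauto), mul_zero]

lemma R_swap_comm_A {n : ℕ} {i j : Fin n} (h : i ≠ j) : R j i * A i j = A i j * R j i := by
  rw [R_mul_A, sub_eq_self, Finset.sum_eq_zero, Finset.sum_eq_zero, sub_zero]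
  all_goals
    intro x _
    rw [delta, if_neg (by tauto), zero_mul]

lemma R_swap_comm_E {n : ℕ} (i j : Fin n) : R j i * E i j = E i j * R j i := by
  rw [R_mul_E, add_eq_left, Finset.sum_eq_zero, Finset.sum_eq_zero, sub_zero]
  all_goals
    intro x _
    unfold delta
    split_ifs with hx
    · first
      | rw [hx.2.1, E_self, zero_mul]
      | rw [hx.2.2, E_self, zero_mul]
    · simp

/-- The commutator of `R i j` and `R j i`, a diagonal operator. -/
def H {n : ℕ} (i j : Fin n) : Module.End ℤ (Fock n) :=
  ∑ x, ((if x < i then E x j * A x j else 0) - E x i * A x i) +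
    ∑ z, ((if j < z then E i z * A i z else 0) - E j z * A j z)

lemma R_mul_R {n : ℕ} {i j : Fin n} (h : i < j) : R i j * R j i = R j i * R i j + H i j := by
  have key (a b c e r s t u : Fin n) : E a b * A c e * (E r s * A t u)
      = E r s * A t u * (E a b * A c e) + (E a b * delta c e r s * A t u
        - E r s * delta t u a b * A c e) := by
    have h1 := A_mul_E c e r s
    have h2 := A_mul_E t u a b
    have h3 := E_mul_E a b r s
    have h4 := A_mul_A c e t u
    calc _ = E a b * (A c e * E r s) * A t u := by noncomm_ring
      _ = E a b * delta c e r s * A t u - (E a b * E r s) * (A c e * A t u) := by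
        rw [h1]; noncomm_ring
      _ = E a b * delta c e r s * A t u + E r s * (- (E a b * A t u)) * A c e := by
        rw [h3, h4]; noncomm_ring
      _ = E a b * delta c e r s * A t u + E r s * (A t u * E a b - delta t u a b) * A c e := by
        rw [h2]; noncomm_ring
      _ = _ := by noncomm_ring
  have z2 (x w : Fin n) : E x j * A x i * (E j w * A i w) = E j w * A i w * (E x j * A x i) := by
    rw [key, add_eq_left, delta, if_neg (by grind), delta]
    split_ifs with hx
    · obtain ⟨-, rfl, rfl⟩ := hx; simp [E_self]
    · simp
  have z3 (z u : Fin n) : E i z * A j z * (E u i * A u j) = E u i * A u j * (E i z * A j z) := by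
    rw [key, add_eq_left, delta, if_neg (by grind), delta]
    split_ifs with hx
    · obtain ⟨-, rfl, rfl⟩ := hx; simp [E_self]
    · simp
  have s1 : (∑ x, E x j * A x i) * ∑ u, E u i * A u j
      = (∑ u, E u i * A u j) * (∑ x, E x j * A x i)
        + ∑ x, ((if x < i then E x j * A x j else 0) - E x i * A x i) := by
    simp only [Finset.sum_mul_sum]
    rw [Finset.sum_comm (s := Finset.univ) (t := Finset.univ) (f := fun u x =>
      E u i * A u j * (E x j * A x i)), ← Finset.sum_add_distrib]
    refine Finset.sum_congr rfl fun x _ => ?_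
    rw [Finset.sum_congr rfl fun u _ => key x j x i u i u j, Finset.sum_add_distrib,
      Finset.sum_sub_distrib]
    congr 2
    · rw [Finset.sum_eq_single x]
      · by_cases hx : x < i <;> simp [delta, hx]
      · intro u _ hu; simp [delta, hu.symm]
      · simp
    · rw [Finset.sum_eq_single x]
      · by_cases hx : x < i
        · simp [delta, hx.trans h]
        · simp [A_eq_zero hx]
      · intro u _ hu; simp [delta, hu]
      · simp
  have s4 : (∑ z, E i z * A j z) * ∑ w, E j w * A i w
      = (∑ w, E j w * A i w) * (∑ z, E i z * A j z)
        + ∑ z, ((if j < z then E i z * A i z else 0) - E j z * A j z) := by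
    simp only [Finset.sum_mul_sum]
    rw [Finset.sum_comm (s := Finset.univ) (t := Finset.univ) (f := fun w z =>
      E j w * A i w * (E i z * A j z)), ← Finset.sum_add_distrib]
    refine Finset.sum_congr rfl fun z _ => ?_
    rw [Finset.sum_congr rfl fun u _ => key i z j z j u i u, Finset.sum_add_distrib,
      Finset.sum_sub_distrib]
    congr 2
    · rw [Finset.sum_eq_single z]
      · by_cases hz : j < z <;> simp [delta, hz]
      · intro u _ hu; simp [delta, hu.symm]
      · simp
    · rw [Finset.sum_eq_single z]
      · by_cases hz : j < z
        · simp [delta, h.trans hz]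
        · simp [A_eq_zero hz]
      · intro u _ hu; simp [delta, hu]
      · simp
  have s2 : (∑ x, E x j * A x i) * ∑ w, E j w * A i w
      = (∑ w, E j w * A i w) * ∑ x, E x j * A x i := by
    simp only [Finset.sum_mul_sum, z2]; exact Finset.sum_comm
  have s3 : (∑ z, E i z * A j z) * ∑ u, E u i * A u j
      = (∑ u, E u i * A u j) * ∑ z, E i z * A j z := by
    simp only [Finset.sum_mul_sum, z3]; exact Finset.sum_comm
  simp only [R, H, sub_mul, mul_sub, s1, s2, s3, s4]
  abel

/-- Functions supported on basis wedges of degree `k` and modified weight `w`. -/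
def V {n : ℕ} (k : ℤ) (w : Fin n → ℤ) : Submodule ℤ (Fock n) where
  carrier := {v | ∀ S, v S ≠ 0 → (S.card : ℤ) = k ∧ wt S = w}
  zero_mem' := by simp
  add_mem' {u v} hu hv S hS := by
    by_cases h : u S = 0
    · exact hv S (by simpa [h] using hS)
    · exact hu S h
  smul_mem' c v hv S hS := hv S (right_ne_zero_of_mul hS)

lemma wt_insert {n : ℕ} {p : P n} {S : Finset (P n)} (h : p ∉ S) :
    wt (insert p S) = wt S + Pi.single p.1.1 1 - Pi.single p.1.2 1 := by
  funext t
  simp only [wt, Pi.add_apply, Pi.sub_apply, Finset.filter_insert, Pi.single_apply,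
    eq_comm (a := t)]
  split_ifs <;> simp [h] <;> ring

lemma wt_erase {n : ℕ} {p : P n} {S : Finset (P n)} (h : p ∈ S) :
    wt (S.erase p) = wt S - Pi.single p.1.1 1 + Pi.single p.1.2 1 := by
  conv_rhs => rw [← Finset.insert_erase h, wt_insert (Finset.notMem_erase p S)]
  abel

lemma A_mem {n : ℕ} {k : ℤ} {w : Fin n → ℤ} {v : Fock n} (hv : v ∈ V k w) (x y : Fin n) :
    A x y v ∈ V (k - 1) (w - Pi.single x 1 + Pi.single y 1) := by
  unfold A
  split_ifs with h
  · intro S hS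
    rw [ann_apply] at hS
    split_ifs at hS with hp
    · exact absurd rfl hS
    · obtain ⟨h1, h2⟩ := hv _ (right_ne_zero_of_mul hS)
      rw [Finset.card_insert_of_notMem hp] at h1
      rw [wt_insert hp] at h2
      exact ⟨by push_cast at h1; omega, by rw [← h2]; abel⟩
  · simp

lemma E_mem {n : ℕ} {k : ℤ} {w : Fin n → ℤ} {v : Fock n} (hv : v ∈ V k w) (x y : Fin n) :
    E x y v ∈ V (k + 1) (w + Pi.single x 1 - Pi.single y 1) := by
  unfold E
  split_ifs with h
  · intro S hS
    rw [cre_apply] at hS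
    split_ifs at hS with hp
    · obtain ⟨h1, h2⟩ := hv _ (right_ne_zero_of_mul hS)
      rw [← Finset.card_erase_add_one hp]
      rw [wt_erase hp] at h2
      exact ⟨by push_cast; omega, by rw [← h2]; abel⟩
    · exact absurd rfl hS
  · simp

lemma V_congr {n : ℕ} {k l : ℤ} {w u : Fin n → ℤ} {v : Fock n} (hv : v ∈ V k w) (h : k = l)
    (h' : w = u) : v ∈ V l u := h ▸ h' ▸ hv

lemma D_mem {n : ℕ} {k : ℤ} {w : Fin n → ℤ} {v : Fock n} (hv : v ∈ V k w) :
    D n v ∈ V (k - 1) w := by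
  simp only [D, LinearMap.sum_apply]
  refine Submodule.sum_mem _ fun x _ => Submodule.sum_mem _ fun y _ =>
    Submodule.sum_mem _ fun z _ => ?_
  exact V_congr (E_mem (A_mem (A_mem hv y z) x y) x z) (by ring) (by abel)

lemma R_mem {n : ℕ} {k : ℤ} {w : Fin n → ℤ} {v : Fock n} (hv : v ∈ V k w) (i j : Fin n) :
    R i j v ∈ V k (w + Pi.single i 1 - Pi.single j 1) := by
  simp only [R, LinearMap.sub_apply, LinearMap.sum_apply]
  refine Submodule.sub_mem _ (Submodule.sum_mem _ fun x _ => ?_)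
    (Submodule.sum_mem _ fun z _ => ?_)
  · exact V_congr (E_mem (A_mem hv x i) x j) (by ring) (by abel)
  · exact V_congr (E_mem (A_mem hv j z) i z) (by ring) (by abel)

/-- The indicator of `(x, y) ∈ S`, and `0` unless `x < y`. -/
def chi {n : ℕ} (S : Finset (P n)) (x y : Fin n) : ℤ :=
  if h : x < y then (if ⟨(x, y), h⟩ ∈ S then 1 else 0) else 0

lemma chi_eq_zero {n : ℕ} {S : Finset (P n)} {x y : Fin n} (h : ¬ x < y) : chi S x y = 0 :=
  dif_neg h

lemma number_apply {n : ℕ} (x y : Fin n) (v : Fock n) (S : Finset (P n)) :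
    (E x y * A x y) v S = chi S x y * v S := by
  unfold E A chi
  split_ifs with h h'
  · simp [cre_apply, ann_apply, h', sgn_erase _ _ h', ← mul_assoc]
  · simp [cre_apply, h']
  · simp

lemma sum_pairs {n : ℕ} {M : Type*} [AddCommMonoid M] (f : P n → M) :
    ∑ p, f p = ∑ x, ∑ y, if h : x < y then f ⟨(x, y), h⟩ else 0 := by
  rw [← Fintype.sum_prod_type' (f := fun x y => if h : x < y then f ⟨(x, y), h⟩ else 0)]
  trans ∑ q ∈ Finset.univ.filter fun q : Fin n × Fin n => q.1 < q.2,
    if h : q.1 < q.2 then f ⟨q, h⟩ else 0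
  · rw [Finset.sum_subtype (p := fun q : Fin n × Fin n => q.1 < q.2) _ (by simp)]
    exact Finset.sum_congr rfl fun p _ => by rw [dif_pos p.2]
  · exact Finset.sum_filter_of_ne fun q _ hq => by
      by_contra h
      exact hq (dif_neg h)

lemma card_filter_snd {n : ℕ} (S : Finset (P n)) (i : Fin n) :
    ((S.filter fun p => p.1.2 = i).card : ℤ) = ∑ x, chi S x i := by
  have : ((S.filter fun p => p.1.2 = i).card : ℤ)
      = ∑ p : P n, if p ∈ S ∧ p.1.2 = i then 1 else 0 := by
    rw [Finset.sum_boole]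
    congr 2
    ext p; simp
  rw [this, sum_pairs]
  refine Finset.sum_congr rfl fun x _ => ?_
  rw [Finset.sum_eq_single i]
  · simp [chi]
  · intro y _ hy; simp [hy]
  · simp

lemma card_filter_fst {n : ℕ} (S : Finset (P n)) (i : Fin n) :
    ((S.filter fun p => p.1.1 = i).card : ℤ) = ∑ y, chi S i y := by
  have : ((S.filter fun p => p.1.1 = i).card : ℤ)
      = ∑ p : P n, if p ∈ S ∧ p.1.1 = i then 1 else 0 := by
    rw [Finset.sum_boole]
    congr 2
    ext p; simp
  rw [this, sum_pairs, Finset.sum_eq_single i]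
  · simp [chi]
  · intro x _ hx; simp [hx]
  · simp

lemma wt_eq {n : ℕ} (S : Finset (P n)) (i : Fin n) :
    wt S i = i.1 + 1 - ∑ x, chi S x i + ∑ y, chi S i y := by
  rw [← card_filter_snd, ← card_filter_fst, wt]

lemma one_le_wt {n : ℕ} (S : Finset (P n)) (i : Fin n) : 1 ≤ wt S i := by
  have h1 : ∑ x, chi S x i ≤ i.1 := by
    calc ∑ x, chi S x i ≤ ∑ x, if x < i then 1 else 0 :=
          Finset.sum_le_sum fun x _ => by unfold chi; split_ifs <;> simp
      _ = i.1 := by rw [Finset.sum_boole, Finset.filter_gt_eq_Iio, Fin.card_Iio]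
  have h2 : 0 ≤ ∑ y, chi S i y :=
    Finset.sum_nonneg fun x _ => by unfold chi; split_ifs <;> simp
  rw [wt_eq]
  omega

lemma wt_le {n : ℕ} (S : Finset (P n)) (i : Fin n) : wt S i ≤ n := by
  have h1 : 0 ≤ ∑ x, chi S x i :=
    Finset.sum_nonneg fun x _ => by unfold chi; split_ifs <;> simp
  have h2 : ∑ y, chi S i y ≤ (n - 1 - i.1 : ℕ) := by
    calc ∑ y, chi S i y ≤ ∑ y, if i < y then 1 else 0 :=
          Finset.sum_le_sum fun x _ => by unfold chi; split_ifs <;> simp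
      _ = (n - 1 - i.1 : ℕ) := by rw [Finset.sum_boole, Finset.filter_lt_eq_Ioi, Fin.card_Ioi]
  rw [wt_eq]
  omega

lemma eq_zero_of_mem {n : ℕ} {k : ℤ} {w : Fin n → ℤ} {v : Fock n} (hv : v ∈ V k w) (i : Fin n)
    (h : w i < 1 ∨ (n : ℤ) < w i) : v = 0 := by
  funext S
  by_contra hS
  have h2 := (hv S hS).2
  have := one_le_wt S i
  have := wt_le S i
  rw [h2] at *
  omega

lemma H_apply {n : ℕ} {i j : Fin n} (hij : i.1 + 1 = j.1) {k : ℤ} {w : Fin n → ℤ} {v : Fock n}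
    (hv : v ∈ V k w) (hw : w i = w j) : H i j v = v - 2 • (E i j * A i j) v := by
  have hlt : i < j := Fin.lt_def.2 (by omega)
  have e1 (S : Finset (P n)) : ∑ x, (if x < i then chi S x j else 0)
      = ∑ x, chi S x j - chi S i j := by
    rw [eq_sub_iff_add_eq, ← Finset.sum_erase_add _ _ (Finset.mem_univ i),
      ← Finset.sum_erase_add (a := i) Finset.univ (fun x => chi S x j) (Finset.mem_univ i),
      if_neg (lt_irrefl i), add_zero]
    congr 1
    refine Finset.sum_congr rfl fun x hx => ?_
    have := Finset.ne_of_mem_erase hx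
    split_ifs with h
    · rfl
    · exact (chi_eq_zero (by simp only [Fin.lt_def, ne_eq, Fin.ext_iff] at *; omega)).symm
  have e2 (S : Finset (P n)) : ∑ z, (if j < z then chi S i z else 0)
      = ∑ z, chi S i z - chi S i j := by
    rw [eq_sub_iff_add_eq, ← Finset.sum_erase_add _ _ (Finset.mem_univ j),
      ← Finset.sum_erase_add (a := j) Finset.univ (fun x => chi S i x) (Finset.mem_univ j),
      if_neg (lt_irrefl j), add_zero]
    congr 1
    refine Finset.sum_congr rfl fun x hx => ?_
    have := Finset.ne_of_mem_erase hx
    split_ifs with h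
    · rfl
    · exact (chi_eq_zero (by simp only [Fin.lt_def, ne_eq, Fin.ext_iff] at *; omega)).symm
  funext S
  have hH : H i j v S = (∑ x, ((if x < i then chi S x j else 0) - chi S x i)
      + ∑ z, ((if j < z then chi S i z else 0) - chi S j z)) * v S := by
    simp only [H, LinearMap.add_apply, LinearMap.sum_apply, LinearMap.sub_apply, Pi.add_apply,
      Finset.sum_apply, Pi.sub_apply, add_mul, Finset.sum_mul, sub_mul, ite_mul, zero_mul,
      number_apply]
    congr 1 <;> refine Finset.sum_congr rfl fun x _ => ?_ <;> split_ifs <;>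
      simp [number_apply]
  rw [hH, Pi.sub_apply, Pi.smul_apply, number_apply]
  by_cases hS : v S = 0
  · simp [hS]
  have hi := congrFun (hv S hS).2 i
  have hj := congrFun (hv S hS).2 j
  rw [wt_eq] at hi hj
  simp only [Finset.sum_sub_distrib, e1, e2]
  have : ∑ x, chi S x j - chi S i j - ∑ x, chi S x i + (∑ z, chi S i z - chi S i j
      - ∑ z, chi S j z) = 1 - 2 * chi S i j := by
    have : (j.1 : ℤ) = i.1 + 1 := by omega
    linarith
  rw [this]
  simp only [nsmul_eq_mul]
  push_cast
  ring

/-- The contracting homotopy. -/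
def G {n : ℕ} (i j : Fin n) : Module.End ℤ (Fock n) := E i j * R j i

lemma G_mem {n : ℕ} {k : ℤ} {w : Fin n → ℤ} {v : Fock n} (hv : v ∈ V k w) (i j : Fin n) :
    G i j v ∈ V (k + 1) w :=
  V_congr (E_mem (R_mem hv j i) i j) rfl (by abel)

lemma A_sq {n : ℕ} (x y : Fin n) : A x y * A x y = 0 := by
  unfold A
  split_ifs with h
  · refine LinearMap.ext fun v => funext fun S => ?_
    simp [ann_apply]
  · simp

lemma E_sq {n : ℕ} (x y : Fin n) : E x y * E x y = 0 := by
  unfold E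
  split_ifs with h
  · refine LinearMap.ext fun v => funext fun S => ?_
    simp [cre_apply]
  · simp

lemma A_mul_E_self {n : ℕ} {i j : Fin n} (h : i < j) : A i j * E i j = 1 - E i j * A i j := by
  rw [A_mul_E, delta, if_pos ⟨h, rfl, rfl⟩]

lemma D_anticomm_A {n : ℕ} {i j : Fin n} (hij : i.1 + 1 = j.1) :
    D n * A i j = -(A i j * D n) := by
  rw [D_mul_A, Finset.sum_eq_zero, zero_sub]
  intro y _
  by_cases h : i < y
  · rw [A_eq_zero (x := y) (by simp only [Fin.lt_def] at *; omega), mul_zero]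
  · rw [A_eq_zero h, zero_mul]

lemma D_commutator {n : ℕ} {i j : Fin n} (hij : i.1 + 1 = j.1) :
    D n * (E i j * A i j) - E i j * A i j * D n = R i j * A i j := by
  have hlt : i < j := Fin.lt_def.2 (by omega)
  have h := D_anticomm_A hij
  calc _ = D n * E i j * A i j - E i j * (A i j * D n) := by noncomm_ring
    _ = R i j * A i j - E i j * (D n * A i j) - E i j * (A i j * D n) := by
      rw [D_mul_E hlt]; noncomm_ring
    _ = _ := by rw [h]; noncomm_ring

section

variable {n : ℕ} {i j : Fin n} {k : ℤ} {w : Fin n → ℤ} {v : Fock n}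

lemma E_R_apply (hij : i.1 + 1 = j.1) (hv : v ∈ V k w) (hadj : w i = w j)
    (hval : w i = 2 ∨ w i = (n : ℤ) - 1) : E i j (R i j v) = 0 := by
  have hne : i ≠ j := by rintro rfl; omega
  have h := E_mem (R_mem hv i j) i j
  rcases hval with h2 | h2
  · exact eq_zero_of_mem h j (by simp [hne]; omega)
  · exact eq_zero_of_mem h i (by simp [hne]; omega)

lemma A_R_apply (hij : i.1 + 1 = j.1) (hv : v ∈ V k w) (hadj : w i = w j)
    (hval : w i = 2 ∨ w i = (n : ℤ) - 1) : A i j (R j i v) = 0 := by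
  have hne : i ≠ j := by rintro rfl; omega
  have h := A_mem (R_mem hv j i) i j
  rcases hval with h2 | h2
  · exact eq_zero_of_mem h i (by simp [hne]; omega)
  · exact eq_zero_of_mem h j (by simp [hne]; omega)

lemma number_mem (hv : v ∈ V k w) : (E i j * A i j) v ∈ V k w :=
  V_congr (E_mem (A_mem hv i j) i j) (by ring) (by abel)

lemma number_sq (h : i < j) : E i j * A i j * (E i j * A i j) = E i j * A i j := by
  calc _ = E i j * (A i j * E i j) * A i j := by noncomm_ring
    _ = E i j * A i j - (E i j * E i j) * (A i j * A i j) := by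
      rw [A_mul_E_self h]; noncomm_ring
    _ = _ := by rw [A_sq, mul_zero, sub_zero]

lemma commutator_G_apply (hij : i.1 + 1 = j.1) (hv : v ∈ V k w) (hadj : w i = w j)
    (hval : w i = 2 ∨ w i = (n : ℤ) - 1) :
    (R i j * A i j * G i j) v = v - (E i j * A i j) v := by
  have hlt : i < j := Fin.lt_def.2 (by omega)
  have h : R i j * A i j * G i j
      = R j i * A i j * (E i j * R i j) + H i j * (1 - E i j * A i j) := by
    calc _ = R i j * ((A i j * E i j) * R j i) := by unfold G; noncomm_ring
      _ = R i j * (A i j * (R j i * E i j)) := by rw [R_swap_comm_E]; noncomm_ring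
      _ = R i j * R j i * (A i j * E i j) := by
        rw [← mul_assoc (A i j), ← R_swap_comm_A hlt.ne]; noncomm_ring
      _ = R j i * ((R i j * A i j) * E i j) + H i j * (A i j * E i j) := by
        rw [R_mul_R hlt]; noncomm_ring
      _ = R j i * (A i j * (R i j * E i j)) + H i j * (A i j * E i j) := by
        rw [R_comm_A]; noncomm_ring
      _ = _ := by rw [R_comm_E hlt.ne, A_mul_E_self hlt]; noncomm_ring
  have hu : (1 - E i j * A i j) v ∈ V k w := Submodule.sub_mem _ hv (number_mem hv)
  rw [h, LinearMap.add_apply, Module.End.mul_apply, Module.End.mul_apply (E i j),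
    E_R_apply hij hv hadj hval, map_zero, zero_add, Module.End.mul_apply, H_apply hij hu hadj,
    ← Module.End.mul_apply, mul_sub, number_sq hlt, mul_one, sub_self]
  simp

lemma G_commutator_apply (hij : i.1 + 1 = j.1) (hv : v ∈ V k w) (hadj : w i = w j)
    (hval : w i = 2 ∨ w i = (n : ℤ) - 1) :
    (G i j * (R i j * A i j)) v = (E i j * A i j) v := by
  have hlt : i < j := Fin.lt_def.2 (by omega)
  have h : G i j * (R i j * A i j)
      = R i j * E i j * (A i j * R j i) - H i j * (E i j * A i j) := by
    calc _ = E i j * (R j i * R i j) * A i j := by unfold G; noncomm_ring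
      _ = R j i * (E i j * R i j) * A i j := by
        rw [← mul_assoc, ← R_swap_comm_E]; noncomm_ring
      _ = (R j i * R i j) * (E i j * A i j) := by rw [← R_comm_E hlt.ne]; noncomm_ring
      _ = (R i j * R j i - H i j) * (E i j * A i j) := by
        rw [R_mul_R hlt, add_sub_cancel_right]
      _ = R i j * (R j i * E i j) * A i j - H i j * (E i j * A i j) := by noncomm_ring
      _ = R i j * E i j * (R j i * A i j) - H i j * (E i j * A i j) := by
        rw [R_swap_comm_E]; noncomm_ring
      _ = _ := by rw [R_swap_comm_A hlt.ne]
  rw [h, LinearMap.sub_apply, Module.End.mul_apply, Module.End.mul_apply (A i j),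
    A_R_apply hij hv hadj hval, map_zero, zero_sub, Module.End.mul_apply (H i j),
    H_apply hij (number_mem hv) hadj, ← Module.End.mul_apply (E i j * A i j), number_sq hlt]
  abel

theorem D_G_apply (hij : i.1 + 1 = j.1) (hv : v ∈ V k w) (hadj : w i = w j)
    (hval : w i = 2 ∨ w i = (n : ℤ) - 1) : D n (G i j v) + G i j (D n v) = v := by
  have hlt : i < j := Fin.lt_def.2 (by omega)
  set f := R i j * A i j with hf
  set N := E i j * A i j with hN
  have hDN : D n * N = f + N * D n := by rw [hf, ← D_commutator hij, hN]; abel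
  have hDf : D n * f = -(f * D n) := by
    rw [hf, ← D_commutator hij]
    simp only [mul_sub, sub_mul, ← mul_assoc, D_sq]
    simp [mul_assoc, D_sq]
  have hGN : G i j * N = 0 := by
    calc _ = E i j * (R j i * E i j) * A i j := by unfold G; rw [hN]; noncomm_ring
      _ = (E i j * E i j) * R j i * A i j := by rw [R_swap_comm_E]; noncomm_ring
      _ = 0 := by rw [E_sq]; simp
  have h1 : (D n * G i j + G i j * D n) (N v) = N v := by
    have : (D n * G i j + G i j * D n) * N = G i j * f := by
      calc _ = D n * (G i j * N) + G i j * (D n * N) := by noncomm_ring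
        _ = _ := by rw [hDN, mul_add, ← mul_assoc (G i j) N, hGN]; simp
    rw [← Module.End.mul_apply, this, G_commutator_apply hij hv hadj hval]
  have h2 : (D n * G i j + G i j * D n) (v - N v) = v - N v := by
    have hu := commutator_G_apply hij hv hadj hval
    have : (D n * G i j + G i j * D n) * (f * G i j)
        = D n * ((G i j * f) * G i j) - G i j * f * (D n * G i j) := by
      calc _ = D n * ((G i j * f) * G i j) + G i j * (D n * f) * G i j := by noncomm_ring
        _ = _ := by rw [hDf]; noncomm_ring
    rw [← hu, ← Module.End.mul_apply, this, LinearMap.sub_apply]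
    have h3 := G_commutator_apply hij (G_mem hv i j) hadj hval
    have h4 := G_commutator_apply hij (D_mem (G_mem hv i j)) hadj hval
    have h5 := congrArg (· (G i j v)) hDN
    simp only [← hf, ← hN, Module.End.mul_apply, LinearMap.add_apply] at h3 h4 h5 ⊢
    rw [h3, h4, h5, add_sub_cancel_right]
  have := congrArg₂ (· + ·) h1 h2
  rw [← map_add, add_sub_cancel] at this
  exact this

end

/-- The function whose only nonzero coefficient is a `1` at `M`. -/
abbrev basisVec {n : ℕ} (M : Finset (P n)) : Fock n := Pi.single M 1

lemma ann_basisVec {n : ℕ} (p : P n) (M : Finset (P n)) :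
    ann p (basisVec M) = if p ∈ M then sgn p M • basisVec (M.erase p) else 0 := by
  funext S
  rw [ann_apply]
  by_cases hM : p ∈ M
  · by_cases hS : p ∈ S
    · have : S ≠ M.erase p := by rintro rfl; simp at hS
      simp [hS, hM, this]
    · have : insert p S = M ↔ S = M.erase p := by
        constructor
        · rintro rfl; rw [Finset.erase_insert hS]
        · rintro rfl; rw [Finset.insert_erase hM]
      by_cases h : S = M.erase p
      · subst h; simp [hM, sgn_erase p p hM]
      · simp [hS, hM, this, h]
  · have : insert p S ≠ M := by rintro rfl; simp at hM
    simp [hM, this]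

lemma cre_basisVec {n : ℕ} (p : P n) (M : Finset (P n)) :
    cre p (basisVec M) = if p ∈ M then 0 else sgn p M • basisVec (insert p M) := by
  funext S
  rw [cre_apply]
  by_cases hM : p ∈ M
  · have : S.erase p ≠ M := by rintro rfl; simp at hM
    simp [hM, this]
  · by_cases hS : p ∈ S
    · have : S.erase p = M ↔ S = insert p M := by
        constructor
        · rintro rfl; rw [Finset.insert_erase hS]
        · rintro rfl; rw [Finset.erase_insert hM]
      by_cases h : S = insert p M
      · subst h; simp [hM, sgn_insert p p hM]
      · simp [hS, hM, this, h]
    · have : S ≠ insert p M := by rintro rfl; simp at hS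
      simp [hS, hM, this]

lemma D_eq_sum (n : ℕ) : D n = ∑ a : P n, ∑ b : P n,
    if h : a.1.2 = b.1.1 then cre ⟨(a.1.1, b.1.2), lt_trans a.2 (by rw [h]; exact b.2)⟩ *
      ann a * ann b else 0 := by
  rw [sum_pairs (M := Module.End ℤ (Fock n)), D]
  refine Finset.sum_congr rfl fun x _ => Finset.sum_congr rfl fun y _ => ?_
  by_cases hxy : x < y
  · rw [dif_pos hxy, sum_pairs (M := Module.End ℤ (Fock n))]
    refine Eq.trans ?_ (Finset.sum_eq_single y ?_ ?_).symm
    · refine Finset.sum_congr rfl fun z _ => ?_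
      by_cases hyz : y < z
      · simp [E, A, hxy, hyz, hxy.trans hyz]
      · simp [A_eq_zero hyz, hyz]
    · intro u _ hu; simp [hu.symm]
    · simp
  · simp [A_eq_zero hxy, hxy]

/-- Extension by zero of a chain of degree `k`. -/
noncomputable def extC (n : ℕ) (k : ℤ) : C n k →ₗ[ℤ] Fock n :=
  Finsupp.lsum ℤ fun M => LinearMap.toSpanSingleton ℤ (Fock n) (basisVec M.1)

lemma extC_single {n : ℕ} {k : ℤ} (M : B n k) (c : ℤ) :
    extC n k (Finsupp.single M c) = c • basisVec M.1 := by
  simp [extC]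

lemma cre_ann_ann_basisVec {n : ℕ} {M : Finset (P n)} {a b c : P n} (ha : a ∈ M) (hb : b ∈ M)
    (hab : key a < key b) (hc : c ∉ (M.erase a).erase b) :
    (cre c * ann a * ann b) (basisVec M) =
      (-1 : ℤ) ^ (pos M a + pos M b + pos (insert c ((M.erase a).erase b)) c) •
        basisVec (insert c ((M.erase a).erase b)) := by
  have hne : a ≠ b := by rintro rfl; omega
  rw [Finset.erase_right_comm] at hc ⊢
  have h1 : sgn a (M.erase b) = sgn a M := by
    rw [sgn_erase _ _ hb, if_neg (by omega), one_mul]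
  have h2 : sgn c ((M.erase b).erase a) = sgn c (insert c ((M.erase b).erase a)) := by
    rw [sgn_insert _ _ hc, if_neg (lt_irrefl _), one_mul]
  simp only [Module.End.mul_apply, ann_basisVec, if_pos hb, map_smul,
    if_pos (Finset.mem_erase.2 ⟨hne, ha⟩), cre_basisVec, if_neg hc, h1, h2, smul_smul]
  congr 1
  simp only [sgn, pow_add]
  ring

lemma extC_dAux {n : ℕ} {k : ℤ} {M : Finset (P n)} (hM : (M.card : ℤ) = k + 1) :
    extC n k (dAux k M) = D n (basisVec M) := by
  rw [dAux, D_eq_sum, map_sum, LinearMap.sum_apply]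
  rw [← Finset.sum_subset (Finset.subset_univ M)]
  · refine Finset.sum_congr rfl fun a ha => ?_
    rw [map_sum, LinearMap.sum_apply, ← Finset.sum_subset (Finset.subset_univ M)]
    · refine Finset.sum_congr rfl fun b hb => ?_
      split_ifs with hab
      · have hlt : key a < key b := by
          have h1 : a.1.1.1 < b.1.1.1 := by rw [← hab]; exact a.2
          have h2 := a.1.2.2
          simp only [key]
          nlinarith
        have hne : a ≠ b := by rintro rfl; omega
        have hcard : ((M.erase a).erase b).card + 2 = M.card := by
          rw [← Finset.card_erase_add_one ha,
            ← Finset.card_erase_add_one (Finset.mem_erase.2 ⟨hne.symm, hb⟩)]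
        generalize_proofs hc
        by_cases hmem : (⟨(a.1.1, b.1.2), hc⟩ : P n) ∈ (M.erase a).erase b
        · rw [dif_neg]
          · rw [Finset.erase_right_comm] at hmem
            simp [ann_basisVec, hb, ha, hne, cre_basisVec, hmem, -zsmul_eq_mul]
          · rw [Finset.insert_eq_of_mem hmem]; omega
        · rw [dif_pos, map_smul, extC_single, one_smul, cre_ann_ann_basisVec ha hb hlt hmem]
          rw [Finset.card_insert_of_notMem hmem]; push_cast; omega
      · simp
    · intro b _ hb
      split_ifs <;> simp [ann_basisVec, hb]
  · intro a _ ha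
    rw [LinearMap.sum_apply]
    refine Finset.sum_eq_zero fun b _ => ?_
    split_ifs
    · by_cases hb : b ∈ M <;> simp [ann_basisVec, hb, ha, -zsmul_eq_mul]
    · simp

lemma extC_d {n : ℕ} {k : ℤ} (x : C n (k + 1)) : extC n k (d n k x) = D n (extC n (k + 1) x) := by
  induction x using Finsupp.induction_linear with
  | zero => simp
  | add x y hx hy => simp only [map_add, hx, hy]
  | single M c => simp [d, extC_single, extC_dAux M.2, -zsmul_eq_mul]

/-- Extension by zero of a chain of degree `k` and weight `w`. -/
noncomputable def extW (n : ℕ) (k : ℤ) (w : Fin n → ℤ) : Cw n k w →ₗ[ℤ] Fock n :=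
  extC n k ∘ₗ inclW n k w

lemma extW_single {n : ℕ} {k : ℤ} {w : Fin n → ℤ} (M : Bw n k w) (c : ℤ) :
    extW n k w (Finsupp.single M c) = c • basisVec M.1 := by
  simp [extW, inclW, extC_single]

lemma extW_apply {n : ℕ} {k : ℤ} {w : Fin n → ℤ} (x : Cw n k w) (M : Bw n k w) :
    extW n k w x M.1 = x M := by
  induction x using Finsupp.induction_linear with
  | zero => simp
  | add x y hx hy => simp [hx, hy]
  | single N c =>
    rw [extW_single]
    simp [Finsupp.single_apply, Pi.single_apply, Subtype.ext_iff, eq_comm]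

lemma extW_injective (n : ℕ) (k : ℤ) (w : Fin n → ℤ) : Function.Injective (extW n k w) := by
  intro x y h
  ext M
  rw [← extW_apply, h, extW_apply]

lemma extW_mem {n : ℕ} {k : ℤ} {w : Fin n → ℤ} (x : Cw n k w) : extW n k w x ∈ V k w := by
  induction x using Finsupp.induction_linear with
  | zero => simp
  | add x y hx hy => rw [map_add]; exact Submodule.add_mem _ hx hy
  | single N c =>
    rw [extW_single]
    refine Submodule.smul_mem _ _ fun S hS => ?_
    obtain rfl : S = N.1 := by
      by_contra h
      exact hS (by simp [h])
    exact N.2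

/-- Restriction to the basis wedges of degree `k` and weight `w`. -/
noncomputable def resW (n : ℕ) (k : ℤ) (w : Fin n → ℤ) : Fock n →ₗ[ℤ] Cw n k w :=
  (Finsupp.linearEquivFunOnFinite ℤ ℤ (Bw n k w)).symm.toLinearMap ∘ₗ
    LinearMap.funLeft ℤ ℤ Subtype.val

lemma resW_apply {n : ℕ} {k : ℤ} {w : Fin n → ℤ} (v : Fock n) (M : Bw n k w) :
    resW n k w v M = v M.1 := rfl

lemma extW_resW {n : ℕ} {k : ℤ} {w : Fin n → ℤ} {v : Fock n} (hv : v ∈ V k w) :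
    extW n k w (resW n k w v) = v := by
  funext S
  by_cases hS : (S.card : ℤ) = k ∧ wt S = w
  · exact extW_apply _ ⟨S, hS⟩
  · have h1 : v S = 0 := by_contra fun h => hS (hv S h)
    have h2 : extW n k w (resW n k w v) S = 0 := by_contra fun h => hS (extW_mem _ S h)
    rw [h1, h2]

lemma projW_eq {n : ℕ} {k : ℤ} {w : Fin n → ℤ} (x : C n k) :
    projW n k w x = resW n k w (extC n k x) := by
  induction x using Finsupp.induction_linear with
  | zero => simp
  | add x y hx hy => simp [hx, hy]
  | single N c =>
    ext M
    rw [resW_apply, extC_single, projW, Finsupp.lsum_single]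
    split_ifs with h
    · simp [Finsupp.single_apply, Pi.single_apply, Subtype.ext_iff, eq_comm]
    · have : M.1 ≠ N.1 := by rintro h'; exact h (h' ▸ M.2.2)
      simp [this]

lemma extW_dW {n : ℕ} {k : ℤ} {w : Fin n → ℤ} (x : Cw n (k + 1) w) :
    extW n k w (dW n k w x) = D n (extW n (k + 1) w x) := by
  have h : D n (extW n (k + 1) w x) ∈ V k w := V_congr (D_mem (extW_mem x)) (by ring) rfl
  rw [dW, LinearMap.comp_apply, LinearMap.comp_apply, projW_eq, extC_d]
  exact extW_resW h

lemma extW_castCw {n : ℕ} {k l : ℤ} {w : Fin n → ℤ} (h : k = l) (x : Cw n k w) :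
    extW n l w (castCw n w h x) = extW n k w x := by
  induction x using Finsupp.induction_linear with
  | zero => simp
  | add x y hx hy => simp only [map_add, hx, hy]
  | single N c => simp [castCw, extW_single]

lemma extW_dFromW {n : ℕ} {k : ℤ} {w : Fin n → ℤ} (x : Cw n k w) :
    extW n (k - 1) w (dFromW n k w x) = D n (extW n k w x) := by
  rw [dFromW, LinearMap.comp_apply, extW_dW]
  exact congrArg _ (extW_castCw _ x)

/-- Lemma 3.2: `⟦…,2,2,…⟧ ≃ 0` and `⟦…,n-1,n-1,…⟧ ≃ 0`: the weight summand is chain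
homotopy equivalent to the zero complex (the identity is null-homotopic), and in
particular all homology vanishes. -/
theorem adjacent_repeat_contractible (n : ℕ) (w : Fin n → ℤ) (hw : Sn n w)
    (i : Fin n) (hi : i.1 + 1 < n) (hadj : w i = w ⟨i.1 + 1, hi⟩)
    (hval : w i = 2 ∨ w i = (n : ℤ) - 1) :
    (∃ h : (k : ℤ) → Cw n k w →ₗ[ℤ] Cw n (k + 1) w,
      ∀ k : ℤ,
        (dW n k w) ∘ₗ (h k) +
          (castCw n w (by ring : k - 1 + 1 = k)).toLinearMap ∘ₗ (h (k - 1)) ∘ₗ (dFromW n k w) =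
        LinearMap.id) ∧
    (∀ k : ℤ, Subsingleton (Hw n k w)) := by
  have hex : ∃ h : (k : ℤ) → Cw n k w →ₗ[ℤ] Cw n (k + 1) w, ∀ k : ℤ,
      (dW n k w) ∘ₗ (h k) +
        (castCw n w (by ring : k - 1 + 1 = k)).toLinearMap ∘ₗ (h (k - 1)) ∘ₗ (dFromW n k w) =
      LinearMap.id := by
    refine ⟨fun k => resW n (k + 1) w ∘ₗ G i ⟨i.1 + 1, hi⟩ ∘ₗ extW n k w, fun k => ?_⟩
    refine LinearMap.ext fun x => extW_injective n k w ?_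
    simp only [LinearMap.add_apply, LinearMap.comp_apply, LinearEquiv.coe_coe, map_add, extW_dW,
      extW_castCw, LinearMap.id_apply]
    rw [extW_resW (G_mem (extW_mem x) _ _), extW_resW (G_mem (extW_mem _) _ _), extW_dFromW]
    exact D_G_apply rfl (extW_mem x) hadj hval
  refine ⟨hex, fun k => ?_⟩
  obtain ⟨h, hh⟩ := hex
  refine Submodule.Quotient.subsingleton_iff.2 (eq_top_iff.2 fun z _ => ?_)
  refine ⟨⟨h k z.1, ?_⟩, z.2⟩
  have hz : dFromW n k w z.1 = 0 := z.2
  have := congrArg (· z.1) (hh k)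
  simpa [hz] using this

end Nil
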